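/- Fix m ∈ [0,1] and a sequence of per-slot success probabilities (q_t)_{t∈ℕ} with m ≤ q_t ≤ 1 for every t. Let P(t) be the state of the three-instance nonpreemptive pull chain driven by (q_t), and let P̄(t) be the state of the chain driven by the constant sequence q_t = m. Then for every slot t the end-to-end reliabilities dominate the worst-case values: E₀(t) ≥ Ē₀(t), E₁(t) ≥ Ē₁(t), and E₂(t) ≥ Ē₂(t), where Ē_i denotes the reliabilities computed from P̄. In other words, the reliabilities computed assuming every link has exactly the minimum quality m are safe lower bounds whenever all actual per-slot link qualities are at least m. -/

import Mathlib

/-- One step of the three-instance nonpreemptive pull chain with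
per-slot success probability `q`. The state `(P₀, P₁, P₂, P₃)` gives the
probabilities that exactly 0, 1, 2, 3 of the instances have succeeded. -/
def pullStep (q : ℝ) (P : ℝ × ℝ × ℝ × ℝ) : ℝ × ℝ × ℝ × ℝ :=
  ((1 - q) * P.1,
   q * P.1 + (1 - q) * P.2.1,
   q * P.2.1 + (1 - q) * P.2.2.1,
   q * P.2.2.1 + P.2.2.2)

/-- The state of the three-instance nonpreemptive pull chain driven by the
sequence of per-slot success probabilities `q`. -/
def pullChain (q : ℕ → ℝ) : ℕ → ℝ × ℝ × ℝ × ℝ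
  | 0 => (1, 0, 0, 0)
  | t + 1 => pullStep (q t) (pullChain q t)

/-- End-to-end reliability of the first instance: at least one success. -/
def E0 (P : ℝ × ℝ × ℝ × ℝ) : ℝ := P.2.1 + P.2.2.1 + P.2.2.2

/-- End-to-end reliability of the second instance: at least two successes. -/
def E1 (P : ℝ × ℝ × ℝ × ℝ) : ℝ := P.2.2.1 + P.2.2.2

/-- End-to-end reliability of the third instance: all three successes. -/
def E2 (P : ℝ × ℝ × ℝ × ℝ) : ℝ := P.2.2.2

theorem pullChain_nonneg {q : ℕ → ℝ} (h0 : ∀ t, 0 ≤ q t) (h1 : ∀ t, q t ≤ 1) (t : ℕ) :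
    0 ≤ (pullChain q t).1 ∧ 0 ≤ (pullChain q t).2.1 ∧ 0 ≤ (pullChain q t).2.2.1 := by
  induction t with
  | zero => simp [pullChain]
  | succ t ih =>
    obtain ⟨hP0, hP1, hP2⟩ := ih
    have hq := h0 t
    have hq' := sub_nonneg.2 (h1 t)
    simp only [pullChain, pullStep]
    exact ⟨by positivity, by positivity, by positivity⟩

theorem pullChain_fst_add_E0 (q : ℕ → ℝ) (t : ℕ) :
    (pullChain q t).1 + E0 (pullChain q t) = 1 := by
  induction t with
  | zero => simp [pullChain, E0]
  | succ t ih =>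
    simp only [pullChain, pullStep, E0] at ih ⊢
    linear_combination ih

theorem E0_pullStep (q : ℝ) (P : ℝ × ℝ × ℝ × ℝ) :
    E0 (pullStep q P) = q * P.1 + E0 P := by
  simp only [pullStep, E0]
  ring

theorem E1_pullStep (q : ℝ) (P : ℝ × ℝ × ℝ × ℝ) :
    E1 (pullStep q P) = q * P.2.1 + E1 P := by
  simp only [pullStep, E1]
  ring

theorem E2_pullStep (q : ℝ) (P : ℝ × ℝ × ℝ × ℝ) :
    E2 (pullStep q P) = q * P.2.2.1 + E2 P := rfl

/-- A gain `q * x` with `q ≥ m` and `x = a - b ≥ 0` preserves domination of `b` when `a` also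
dominates. -/
theorem mul_add_le_mul_add_of_le {m q a b a' b' : ℝ} (hm0 : 0 ≤ m) (hm1 : m ≤ 1) (hmq : m ≤ q)
    (hab : 0 ≤ a - b) (ha : a' ≤ a) (hb : b' ≤ b) :
    m * (a' - b') + b' ≤ q * (a - b) + b := by
  have h1 := mul_le_mul_of_nonneg_left ha hm0
  have h2 := mul_le_mul_of_nonneg_left hb (sub_nonneg.2 hm1)
  have h3 := mul_le_mul_of_nonneg_right hmq hab
  linarith

/-- If every per-slot success probability `q t` satisfies `m ≤ q t ≤ 1`, then
the end-to-end reliabilities of the chain driven by `q` dominate those of the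
chain driven by the constant sequence `m`: the worst-case values are safe
lower bounds. -/
theorem reliabilities_dominate_worst_case
    (m : ℝ) (hm0 : 0 ≤ m) (hm1 : m ≤ 1) (q : ℕ → ℝ)
    (hq : ∀ t, m ≤ q t ∧ q t ≤ 1) (t : ℕ) :
    E0 (pullChain q t) ≥ E0 (pullChain (fun _ => m) t) ∧
    E1 (pullChain q t) ≥ E1 (pullChain (fun _ => m) t) ∧
    E2 (pullChain q t) ≥ E2 (pullChain (fun _ => m) t) := by
  have hnn := pullChain_nonneg (fun t => hm0.trans (hq t).1) (fun t => (hq t).2)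
  induction t with
  | zero => simp [pullChain]
  | succ t ih =>
    obtain ⟨ih0, ih1, ih2⟩ := ih
    obtain ⟨hP0, hP1, hP2⟩ := hnn t
    have e0 (r : ℕ → ℝ) : (pullChain r t).1 = 1 - E0 (pullChain r t) :=
      eq_sub_of_add_eq (pullChain_fst_add_E0 r t)
    have e1 (P : ℝ × ℝ × ℝ × ℝ) : P.2.1 = E0 P - E1 P := by simp only [E0, E1]; ring
    have e2 (P : ℝ × ℝ × ℝ × ℝ) : P.2.2.1 = E1 P - E2 P := by simp only [E1, E2]; ring
    rw [e0] at hP0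
    rw [e1] at hP1
    rw [e2] at hP2
    simp only [pullChain, E0_pullStep, E1_pullStep, E2_pullStep]
    rw [e0 q, e0 fun _ => m, e1 (pullChain q t), e1 (pullChain (fun _ => m) t),
      e2 (pullChain q t), e2 (pullChain (fun _ => m) t)]
    exact ⟨mul_add_le_mul_add_of_le hm0 hm1 (hq t).1 hP0 le_rfl ih0,
      mul_add_le_mul_add_of_le hm0 hm1 (hq t).1 hP1 ih0 ih1,
      mul_add_le_mul_add_of_le hm0 hm1 (hq t).1 hP2 ih1 ih2⟩
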